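/- Let X, Y be totally bounded metric spaces. Then for every a < b, the inclusion-induced map H_k(Rips(X,a)) → H_k(Rips(X,b)) has finite rank; i.e. the Vietoris–Rips persistence module of a totally bounded metric space is q-tame. -/

import Mathlib

/-- The simplicial boundary operator on formal `𝕜`-linear combinations of
`(n+1)`-tuples of vertices of `X`. -/
noncomputable def bdry (𝕜 : Type*) [Field 𝕜] (X : Type*) (n : ℕ) :
    ((Fin (n + 1) → X) →₀ 𝕜) →ₗ[𝕜] ((Fin n → X) →₀ 𝕜) :=
  Finsupp.lift ((Fin n → X) →₀ 𝕜) 𝕜 (Fin (n + 1) → X) fun σ =>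
    ∑ i : Fin (n + 1), ((-1 : 𝕜) ^ (i : ℕ)) • Finsupp.single (σ ∘ i.succAbove) 1

/-- The subspace of chains supported on tuples satisfying `K` (the simplices of
a simplicial complex, given as a predicate on tuples of vertices). -/
noncomputable def chainsIn (𝕜 : Type*) [Field 𝕜] {X : Type*} (n : ℕ)
    (K : (Fin n → X) → Prop) : Submodule 𝕜 ((Fin n → X) →₀ 𝕜) :=
  Submodule.span 𝕜 {c | ∃ σ, K σ ∧ c = Finsupp.single σ (1 : 𝕜)}

/-- The chain map induced by a vertex map `f : X → Y`. -/
noncomputable def pushChain (𝕜 : Type*) [Field 𝕜] {X Y : Type*} (n : ℕ) (f : X → Y) :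
    ((Fin n → X) →₀ 𝕜) →ₗ[𝕜] ((Fin n → Y) →₀ 𝕜) :=
  Finsupp.lmapDomain 𝕜 𝕜 fun σ : Fin n → X => f ∘ σ

/-- The cone operator, prepending the vertex `x` to every tuple. -/
noncomputable def coneChain (𝕜 : Type*) [Field 𝕜] {X : Type*} (n : ℕ) (x : X) :
    ((Fin n → X) →₀ 𝕜) →ₗ[𝕜] ((Fin (n + 1) → X) →₀ 𝕜) :=
  Finsupp.lmapDomain 𝕜 𝕜 fun σ : Fin n → X => (Fin.cons x σ : Fin (n + 1) → X)

/-- The prism operator, a chain homotopy from the identity to `pushChain 𝕜 n f`. -/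
noncomputable def prismChain (𝕜 : Type*) [Field 𝕜] {X : Type*} (f : X → X) :
    (n : ℕ) → ((Fin n → X) →₀ 𝕜) →ₗ[𝕜] ((Fin (n + 1) → X) →₀ 𝕜)
  | 0 => 0
  | n + 1 => Finsupp.lift ((Fin (n + 2) → X) →₀ 𝕜) 𝕜 (Fin (n + 1) → X) fun σ =>
      coneChain 𝕜 (n + 1) (σ 0)
        (coneChain 𝕜 n (f (σ 0)) (Finsupp.single (f ∘ Fin.tail σ) 1) -
          prismChain 𝕜 f n (Finsupp.single (Fin.tail σ) 1))

section

variable {𝕜 : Type*} [Field 𝕜] {X Y : Type*}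

lemma bdry_single (n : ℕ) (σ : Fin (n + 1) → X) :
    bdry 𝕜 X n (Finsupp.single σ 1) =
      ∑ i : Fin (n + 1), ((-1 : 𝕜) ^ (i : ℕ)) • Finsupp.single (σ ∘ i.succAbove) 1 := by
  simp [bdry]

lemma pushChain_single (n : ℕ) (f : X → Y) (σ : Fin n → X) (r : 𝕜) :
    pushChain 𝕜 n f (Finsupp.single σ r) = Finsupp.single (f ∘ σ) r := by
  simp [pushChain]

lemma coneChain_single (n : ℕ) (x : X) (σ : Fin n → X) (r : 𝕜) :
    coneChain 𝕜 n x (Finsupp.single σ r) =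
      Finsupp.single (Fin.cons x σ : Fin (n + 1) → X) r := by
  simp [coneChain]

lemma prismChain_single (f : X → X) (n : ℕ) (σ : Fin (n + 1) → X) :
    prismChain 𝕜 f (n + 1) (Finsupp.single σ 1) =
      coneChain 𝕜 (n + 1) (σ 0)
        (coneChain 𝕜 n (f (σ 0)) (Finsupp.single (f ∘ Fin.tail σ) 1) -
          prismChain 𝕜 f n (Finsupp.single (Fin.tail σ) 1)) := by
  simp [prismChain]

/-- Linear maps out of a space of chains agree if they agree on tuples. -/
lemma chain_hom_ext {n : ℕ} {M : Type*} [AddCommGroup M] [Module 𝕜 M]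
    {φ ψ : ((Fin n → X) →₀ 𝕜) →ₗ[𝕜] M}
    (h : ∀ σ, φ (Finsupp.single σ 1) = ψ (Finsupp.single σ 1)) (c : (Fin n → X) →₀ 𝕜) :
    φ c = ψ c := by
  have : φ = ψ := Finsupp.lhom_ext' fun σ => LinearMap.ext_ring (h σ)
  rw [this]

lemma pushChain_bdry (f : X → Y) (n : ℕ) (c : (Fin (n + 1) → X) →₀ 𝕜) :
    pushChain 𝕜 n f (bdry 𝕜 X n c) = bdry 𝕜 Y n (pushChain 𝕜 (n + 1) f c) := by
  refine chain_hom_ext (φ := pushChain 𝕜 n f ∘ₗ bdry 𝕜 X n)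
    (ψ := bdry 𝕜 Y n ∘ₗ pushChain 𝕜 (n + 1) f) (fun σ => ?_) c
  simp only [LinearMap.comp_apply, bdry_single, pushChain_single, map_sum, map_smul,
    Function.comp_assoc]

lemma bdry_coneChain_zero (x : X) (c : (Fin 0 → X) →₀ 𝕜) :
    bdry 𝕜 X 0 (coneChain 𝕜 0 x c) = c := by
  refine chain_hom_ext (φ := bdry 𝕜 X 0 ∘ₗ coneChain 𝕜 0 x) (ψ := LinearMap.id)
    (fun σ => ?_) c
  simp only [LinearMap.comp_apply, LinearMap.id_apply, coneChain_single, bdry_single]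
  simp [Subsingleton.elim _ σ]

lemma bdry_coneChain_succ (n : ℕ) (x : X) (c : (Fin (n + 1) → X) →₀ 𝕜) :
    bdry 𝕜 X (n + 1) (coneChain 𝕜 (n + 1) x c) = c - coneChain 𝕜 n x (bdry 𝕜 X n c) := by
  refine chain_hom_ext (φ := bdry 𝕜 X (n + 1) ∘ₗ coneChain 𝕜 (n + 1) x)
    (ψ := LinearMap.id - coneChain 𝕜 n x ∘ₗ bdry 𝕜 X n) (fun σ => ?_) c
  simp only [LinearMap.comp_apply, LinearMap.sub_apply, LinearMap.id_apply, coneChain_single,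
    bdry_single, map_sum, map_smul]
  rw [Fin.sum_univ_succ, sub_eq_add_neg, ← Finset.sum_neg_distrib]
  congr 1
  · simp
  · refine Finset.sum_congr rfl fun i _ => ?_
    have : (Fin.cons x σ : Fin (n + 2) → X) ∘ i.succ.succAbove =
        Fin.cons x (σ ∘ i.succAbove) := by
      ext j
      refine Fin.cases ?_ (fun j => ?_) j <;> simp
    rw [this, Fin.val_succ, pow_succ]
    simp

lemma prismChain_coneChain (f : X → X) (n : ℕ) (x : X) (c : (Fin n → X) →₀ 𝕜) :
    prismChain 𝕜 f (n + 1) (coneChain 𝕜 n x c) =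
      coneChain 𝕜 (n + 1) x
        (coneChain 𝕜 n (f x) (pushChain 𝕜 n f c) - prismChain 𝕜 f n c) := by
  refine chain_hom_ext (φ := prismChain 𝕜 f (n + 1) ∘ₗ coneChain 𝕜 n x)
    (ψ := coneChain 𝕜 (n + 1) x ∘ₗ
      (coneChain 𝕜 n (f x) ∘ₗ pushChain 𝕜 n f - prismChain 𝕜 f n)) (fun σ => ?_) c
  simp only [LinearMap.comp_apply, LinearMap.sub_apply, coneChain_single, prismChain_single,
    pushChain_single, Fin.cons_zero, Fin.tail_cons]

lemma pushChain_coneChain (f : X → Y) (n : ℕ) (x : X) (c : (Fin n → X) →₀ 𝕜) :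
    pushChain 𝕜 (n + 1) f (coneChain 𝕜 n x c) = coneChain 𝕜 n (f x) (pushChain 𝕜 n f c) := by
  refine chain_hom_ext (φ := pushChain 𝕜 (n + 1) f ∘ₗ coneChain 𝕜 n x)
    (ψ := coneChain 𝕜 n (f x) ∘ₗ pushChain 𝕜 n f) (fun σ => ?_) c
  simp only [LinearMap.comp_apply, coneChain_single, pushChain_single, Fin.comp_cons]

lemma single_eq_coneChain (n : ℕ) (σ : Fin (n + 1) → X) :
    Finsupp.single σ (1 : 𝕜) = coneChain 𝕜 n (σ 0) (Finsupp.single (Fin.tail σ) 1) := by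
  rw [coneChain_single, Fin.cons_self_tail]

lemma bdry_prismChain (f : X → X) (n : ℕ) (c : (Fin (n + 1) → X) →₀ 𝕜) :
    bdry 𝕜 X (n + 1) (prismChain 𝕜 f (n + 1) c) =
      pushChain 𝕜 (n + 1) f c - c - prismChain 𝕜 f n (bdry 𝕜 X n c) := by
  induction n with
  | zero =>
    refine chain_hom_ext (φ := bdry 𝕜 X 1 ∘ₗ prismChain 𝕜 f 1)
      (ψ := pushChain 𝕜 1 f - LinearMap.id - prismChain 𝕜 f 0 ∘ₗ bdry 𝕜 X 0) (fun σ => ?_) c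
    simp only [LinearMap.comp_apply, LinearMap.sub_apply, LinearMap.id_apply]
    rw [single_eq_coneChain, prismChain_coneChain, bdry_coneChain_succ, pushChain_coneChain]
    simp only [prismChain, LinearMap.zero_apply, sub_zero, bdry_coneChain_zero,
      pushChain_single, Subsingleton.elim (f ∘ Fin.tail σ) (Fin.tail σ)]
  | succ n ih =>
    refine chain_hom_ext (φ := bdry 𝕜 X (n + 2) ∘ₗ prismChain 𝕜 f (n + 2))
      (ψ := pushChain 𝕜 (n + 2) f - LinearMap.id - prismChain 𝕜 f (n + 1) ∘ₗ bdry 𝕜 X (n + 1))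
      (fun σ => ?_) c
    simp only [LinearMap.comp_apply, LinearMap.sub_apply, LinearMap.id_apply]
    rw [single_eq_coneChain]
    simp only [prismChain_coneChain, bdry_coneChain_succ, pushChain_coneChain, map_sub, ih,
      pushChain_bdry]
    abel

lemma chainsIn_map_le {m n : ℕ} {K : (Fin m → X) → Prop} {L : (Fin n → Y) → Prop}
    (φ : ((Fin m → X) →₀ 𝕜) →ₗ[𝕜] ((Fin n → Y) →₀ 𝕜))
    (h : ∀ σ, K σ → φ (Finsupp.single σ 1) ∈ chainsIn 𝕜 n L) {c : (Fin m → X) →₀ 𝕜}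
    (hc : c ∈ chainsIn 𝕜 m K) : φ c ∈ chainsIn 𝕜 n L := by
  have : chainsIn 𝕜 m K ≤ (chainsIn 𝕜 n L).comap φ := by
    refine Submodule.span_le.2 ?_
    rintro _ ⟨σ, hσ, rfl⟩
    exact h σ hσ
  exact this hc

lemma single_mem_chainsIn {n : ℕ} {K : (Fin n → X) → Prop} {σ : Fin n → X} (h : K σ) :
    Finsupp.single σ (1 : 𝕜) ∈ chainsIn 𝕜 n K :=
  Submodule.subset_span ⟨σ, h, rfl⟩

lemma coneChain_mem {n : ℕ} {x : X} {S : Set X} (hx : x ∈ S)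
    {c : (Fin n → X) →₀ 𝕜} (hc : c ∈ chainsIn 𝕜 n fun σ => ∀ i, σ i ∈ S) :
    coneChain 𝕜 n x c ∈ chainsIn 𝕜 (n + 1) fun σ => ∀ i, σ i ∈ S := by
  refine chainsIn_map_le _ (fun σ hσ => ?_) hc
  rw [coneChain_single]
  refine single_mem_chainsIn fun i => ?_
  refine Fin.cases ?_ (fun j => ?_) i
  · simpa using hx
  · simpa using hσ j

/-- The prism over a simplex with vertices in `S` has vertices in `S` and its image. -/
lemma prismChain_single_mem (f : X → X) (S : Set X) (n : ℕ) (σ : Fin n → X)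
    (hσ : ∀ i, σ i ∈ S) :
    prismChain 𝕜 f n (Finsupp.single σ 1) ∈
      chainsIn 𝕜 (n + 1) fun τ => ∀ i, τ i ∈ S ∪ f '' S := by
  induction n with
  | zero => simp [prismChain]
  | succ n ih =>
    rw [prismChain_single]
    refine coneChain_mem (S := S ∪ f '' S) (Or.inl (hσ 0)) (Submodule.sub_mem _ ?_ ?_)
    · refine coneChain_mem (S := S ∪ f '' S) (Or.inr ⟨_, hσ 0, rfl⟩)
        (single_mem_chainsIn fun i => ?_)
      exact Or.inr ⟨_, hσ i.succ, rfl⟩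
    · exact ih _ fun i => hσ i.succ

lemma chainsIn_mono {n : ℕ} {K L : (Fin n → X) → Prop} (h : ∀ σ, K σ → L σ) :
    chainsIn 𝕜 n K ≤ chainsIn 𝕜 n L :=
  Submodule.span_mono fun _ ⟨σ, hσ, hc⟩ => ⟨σ, h σ hσ, hc⟩

lemma prismChain_mem_rips [PseudoMetricSpace X] {f : X → X} {a b : ℝ} (hab : a ≤ b)
    (hf : ∀ x, dist x (f x) ≤ (b - a) / 2) {n : ℕ} {c : (Fin n → X) →₀ 𝕜}
    (hc : c ∈ chainsIn 𝕜 n fun σ => ∀ i j, dist (σ i) (σ j) ≤ a) :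
    prismChain 𝕜 f n c ∈ chainsIn 𝕜 (n + 1) fun σ => ∀ i j, dist (σ i) (σ j) ≤ b := by
  refine chainsIn_map_le _ (fun σ hσ => ?_) hc
  refine chainsIn_mono (fun τ hτ i j => ?_)
    (prismChain_single_mem f (Set.range σ) n σ Set.mem_range_self)
  rcases hτ i with ⟨p, hp⟩ | ⟨_, ⟨p, rfl⟩, hp⟩ <;>
    rcases hτ j with ⟨q, hq⟩ | ⟨_, ⟨q, rfl⟩, hq⟩ <;> rw [← hp, ← hq]
  · linarith [hσ p q]
  · linarith [hσ p q, dist_triangle (σ p) (σ q) (f (σ q)), hf (σ q)]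
  · linarith [hσ p q, dist_triangle (f (σ p)) (σ p) (σ q), hf (σ p),
      dist_comm (f (σ p)) (σ p)]
  · linarith [hσ p q, dist_triangle4 (f (σ p)) (σ p) (σ q) (f (σ q)), hf (σ p), hf (σ q),
      dist_comm (f (σ p)) (σ p)]

lemma fg_of_le_finiteDimensional {V : Type*} [AddCommGroup V] [Module 𝕜 V]
    {S T : Submodule 𝕜 V} (h : S ≤ T) [FiniteDimensional 𝕜 T] : S.FG :=
  Module.Finite.iff_fg.1 (Submodule.finiteDimensional_of_le h)

lemma range_pushChain_fg {f : X → Y} (hf : (Set.range f).Finite) (n : ℕ) :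
    (LinearMap.range (pushChain 𝕜 n f)).FG := by
  have hfin : {τ : Fin n → Y | ∀ i, τ i ∈ Set.range f}.Finite := by
    simpa [Set.pi] using Set.Finite.pi (fun _ : Fin n => hf)
  have hle : LinearMap.range (pushChain 𝕜 n f) ≤
      Submodule.span 𝕜 ((fun τ => Finsupp.single τ (1 : 𝕜)) ''
        {τ : Fin n → Y | ∀ i, τ i ∈ Set.range f}) := by
    rintro _ ⟨c, rfl⟩
    induction c using Finsupp.induction_linear with
    | zero => simp
    | add c d hc hd => rw [map_add]; exact add_mem hc hd
    | single σ r =>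
      rw [pushChain_single, ← mul_one r, ← smul_eq_mul, ← Finsupp.smul_single]
      exact Submodule.smul_mem _ _ (Submodule.subset_span ⟨_, fun i => ⟨σ i, rfl⟩, rfl⟩)
  have := FiniteDimensional.span_of_finite 𝕜 (hfin.image fun τ => Finsupp.single τ (1 : 𝕜))
  exact fg_of_le_finiteDimensional hle

/-- A linear map of finite rank on `Z` is determined, up to its kernel, by finitely many
elements of `Z`. -/
lemma exists_finite_family_of_map_fg {V W : Type*} [AddCommGroup V] [Module 𝕜 V]
    [AddCommGroup W] [Module 𝕜 W] (φ : V →ₗ[𝕜] W) (Z : Submodule 𝕜 V) (h : (Z.map φ).FG) :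
    ∃ (n : ℕ) (g : Fin n → V), (∀ i, g i ∈ Z) ∧
      ∀ z ∈ Z, ∃ cf : Fin n → 𝕜, φ (z - ∑ i, cf i • g i) = 0 := by
  obtain ⟨n, s, hs⟩ := Submodule.fg_iff_exists_fin_generating_family.1 h
  have hmem : ∀ i, s i ∈ Z.map φ := fun i => hs ▸ Submodule.subset_span ⟨i, rfl⟩
  choose g hg hgs using hmem
  refine ⟨n, g, hg, fun z hz => ?_⟩
  have hz' : φ z ∈ Submodule.span 𝕜 (Set.range s) := hs ▸ Submodule.mem_map_of_mem hz
  obtain ⟨cf, hcf⟩ := (Submodule.mem_span_range_iff_exists_fun 𝕜).1 hz'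
  refine ⟨cf, ?_⟩
  simp [map_sub, map_sum, hgs, hcf]

lemma TotallyBounded.exists_finite_range_dist_lt [PseudoMetricSpace X]
    (hX : TotallyBounded (Set.univ : Set X)) {δ : ℝ} (hδ : 0 < δ) :
    ∃ f : X → X, (Set.range f).Finite ∧ ∀ x, dist x (f x) < δ := by
  obtain ⟨t, ht, hcover⟩ := Metric.totallyBounded_iff.1 hX δ hδ
  have : ∀ x, ∃ y ∈ t, dist x y < δ := fun x => by
    simpa using hcover (Set.mem_univ x)
  choose f hft hf using this
  exact ⟨f, ht.subset (Set.range_subset_iff.2 hft), hf⟩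

end

theorem stmt19 (𝕜 : Type*) [Field 𝕜] {X : Type*} [MetricSpace X]
    (hX : TotallyBounded (Set.univ : Set X))
    (k : ℕ) (a b : ℝ) (hab : a < b) :
    -- the inclusion-induced map H_k(Rips(X,a)) → H_k(Rips(X,b)) has finite rank:
    -- finitely many cycles of Rips(X,a) suffice, up to boundaries in Rips(X,b),
    -- to express every cycle of Rips(X,a)
    ∃ (n : ℕ) (g : Fin n → ((Fin (k + 1) → X) →₀ 𝕜)),
      (∀ i, g i ∈ chainsIn 𝕜 (k + 1)
          (fun σ : Fin (k + 1) → X => ∀ i j, dist (σ i) (σ j) ≤ a) ∧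
        bdry 𝕜 X k (g i) = 0) ∧
      ∀ z ∈ chainsIn 𝕜 (k + 1)
          (fun σ : Fin (k + 1) → X => ∀ i j, dist (σ i) (σ j) ≤ a),
        bdry 𝕜 X k z = 0 →
          ∃ (cf : Fin n → 𝕜) (w : (Fin (k + 2) → X) →₀ 𝕜),
            w ∈ chainsIn 𝕜 (k + 2)
              (fun σ : Fin (k + 2) → X => ∀ i j, dist (σ i) (σ j) ≤ b) ∧
            z - ∑ i, cf i • g i = bdry 𝕜 X (k + 1) w := by
  obtain ⟨f, hfin, hf⟩ := hX.exists_finite_range_dist_lt (half_pos (sub_pos.2 hab))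
  let Z : Submodule 𝕜 ((Fin (k + 1) → X) →₀ 𝕜) :=
    chainsIn 𝕜 (k + 1) (fun σ => ∀ i j, dist (σ i) (σ j) ≤ a) ⊓ LinearMap.ker (bdry 𝕜 X k)
  have hfg : (Z.map (pushChain 𝕜 (k + 1) f)).FG := by
    have : FiniteDimensional 𝕜 (LinearMap.range (pushChain 𝕜 (k + 1) f)) :=
      Module.Finite.iff_fg.2 (range_pushChain_fg hfin (k + 1))
    exact fg_of_le_finiteDimensional LinearMap.map_le_range
  obtain ⟨n, g, hg, hspan⟩ := exists_finite_family_of_map_fg _ Z hfg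
  refine ⟨n, g, hg, fun z hz hz0 => ?_⟩
  obtain ⟨cf, hcf⟩ := hspan z ⟨hz, hz0⟩
  have hmem : z - ∑ i, cf i • g i ∈ Z :=
    Z.sub_mem ⟨hz, hz0⟩ (Z.sum_mem fun i _ => Z.smul_mem _ (hg i))
  refine ⟨cf, -prismChain 𝕜 f (k + 1) (z - ∑ i, cf i • g i),
    neg_mem (prismChain_mem_rips hab.le (fun x => (hf x).le) hmem.1), ?_⟩
  rw [map_neg, bdry_prismChain, hcf, LinearMap.mem_ker.1 hmem.2]
  simp
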